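/- Let p be a prime, P := ∏_{q≠p} ℤ_qˣ, u_p ∈ P the element all of whose components equal p, f a positive integer, N the closure in P of the cyclic subgroup generated by u_p^f, and A := P/N with the quotient topology. Let T be the quotient of A × ℝ₊ by the ℤ-action n·(ā, s) := (u_pⁿ·ā, pⁿ·s), and let ℝ₊ act on T by t·[ā, s] := [ā, t·s]. Then for every a ∈ P the map ℝ₊/p^{fℤ} → T sending the class of s to [aN, s] is well defined and is a homeomorphism onto the ℝ₊-orbit of [aN, 1]. In particular every ℝ₊-orbit of T is a closed orbit, a circle of length f·log p. -/

import Mathlib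

noncomputable section

/-- The multiplicative group of positive real numbers `ℝ₊`. -/
abbrev Rpos : Type := {x : ℝ // (0 : ℝ) < x}

/-- The relation on `G × ℝ₊` given by the `ℤ`-action `n • (h, s) = (gⁿ * h, cⁿ * s)`;
its quotient `Quot (torusRel g c)` is the mapping torus of multiplication by `g`. -/
def torusRel {G : Type*} [Group G] (g : G) (c : Rpos) (x y : G × Rpos) : Prop :=
  ∃ n : ℤ, y = (g ^ n * x.1, c ^ n * x.2)

/-- The mapping torus of multiplication by `g`, with scaling constant `c`. -/
abbrev MappingTorus {G : Type*} [Group G] (g : G) (c : Rpos) : Type _ :=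
  Quot (torusRel g c)

/-- The `ℝ₊`-action on the mapping torus: `t • [h, s] = [h, t * s]`. -/
def torusAct {G : Type*} [Group G] (g : G) (c : Rpos) (t : Rpos) :
    MappingTorus g c → MappingTorus g c :=
  Quot.map (fun x => (x.1, t * x.2)) (by
    rintro x y ⟨n, rfl⟩
    exact ⟨n, by rw [Prod.ext_iff]; exact ⟨rfl, mul_left_comm _ _ _⟩⟩)

instance (p : Nat.Primes) : Fact (Nat.Prime (p : ℕ)) := ⟨p.2⟩

/-- For primes `q ≠ p`, the rational prime `p` is a unit in `ℤ_q`. -/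
theorem pIsUnit (p q : Nat.Primes) (hq : q ≠ p) : IsUnit ((p : ℕ) : ℤ_[(q : ℕ)]) := by
  rw [PadicInt.isUnit_iff]
  refine le_antisymm (PadicInt.norm_le_one _) (not_lt.mp fun hlt => hq ?_)
  have h1 : ‖(((p : ℕ) : ℤ) : ℤ_[(q : ℕ)])‖ < 1 := by exact_mod_cast hlt
  have h2 : ((q : ℕ) : ℤ) ∣ ((p : ℕ) : ℤ) := (PadicInt.norm_int_lt_one_iff_dvd _).mp h1
  exact Nat.Primes.coe_nat_injective
    ((Nat.prime_dvd_prime_iff_eq q.2 p.2).mp (Int.natCast_dvd_natCast.mp h2))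

/-- `Ẑ_{(p)}ˣ = ∏_{q ≠ p} ℤ_qˣ`, the product over all primes `q ≠ p` of the unit groups of the
rings of `q`-adic integers. -/
abbrev PUnits (p : Nat.Primes) : Type :=
  ∀ q : {q : Nat.Primes // q ≠ p}, ℤ_[((q : Nat.Primes) : ℕ)]ˣ

/-- The element `u_p ∈ Ẑ_{(p)}ˣ` all of whose components equal `p`. -/
def uP (p : Nat.Primes) : PUnits p := fun q => (pIsUnit p q.1 q.2).unit

/-- The prime `p` as a positive real number. -/
def pPos (p : Nat.Primes) : Rpos := ⟨((p : ℕ) : ℝ), by exact_mod_cast p.2.pos⟩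

/-- The closure `N` in `Ẑ_{(p)}ˣ` of the cyclic subgroup generated by `u_p^f`. -/
def Ntor (p : Nat.Primes) (f : ℕ) : Subgroup (PUnits p) :=
  (Subgroup.zpowers (uP p ^ f)).topologicalClosure

/-- `A = Ẑ_{(p)}ˣ/N`, with the quotient topology. -/
abbrev Amod (p : Nat.Primes) (f : ℕ) : Type _ := PUnits p ⧸ Ntor p f

/-- The image of `u_p` in `A`. -/
def gbar (p : Nat.Primes) (f : ℕ) : Amod p f := QuotientGroup.mk (uP p)

section MappingTorus

variable {G : Type*} [Group G] {g : G} {c : Rpos}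

theorem torusRel_equivalence (g : G) (c : Rpos) : Equivalence (torusRel g c) where
  refl x := ⟨0, by simp⟩
  symm := by
    rintro x y ⟨n, rfl⟩
    exact ⟨-n, by simp⟩
  trans := by
    rintro x y z ⟨n, rfl⟩ ⟨m, rfl⟩
    exact ⟨m + n, by simp [zpow_add, mul_assoc]⟩

theorem MappingTorus.mk_eq_mk_iff {x y : G × Rpos} :
    (Quot.mk _ x : MappingTorus g c) = Quot.mk _ y ↔ torusRel g c x y :=
  (torusRel_equivalence g c).quot_mk_eq_iff x y

variable {f : ℕ}

/-- The map `ℝ₊/c^{fℤ} → T` sending the class of `s` to `[a, s]`, when `g ^ f = 1`. -/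
def torusOrbitMap (hg : ∀ n : ℤ, g ^ n = 1 ↔ (f : ℤ) ∣ n) (a : G) :
    Rpos ⧸ Subgroup.zpowers (c ^ f) → MappingTorus g c :=
  Quotient.lift (fun s : Rpos => (Quot.mk _ (a, s) : MappingTorus g c)) fun s t hst => by
    obtain ⟨k, hk⟩ := QuotientGroup.leftRel_apply.mp hst
    refine MappingTorus.mk_eq_mk_iff.mpr ⟨f * k, ?_⟩
    have hk' : c ^ ((f : ℤ) * k) = s⁻¹ * t := by rw [zpow_mul, zpow_natCast]; exact hk
    rw [(hg _).mpr (dvd_mul_right _ _), hk', one_mul, mul_comm s⁻¹, inv_mul_cancel_right]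

theorem torusOrbitMap_mk (hg : ∀ n : ℤ, g ^ n = 1 ↔ (f : ℤ) ∣ n) (a : G) (s : Rpos) :
    torusOrbitMap (c := c) hg a (QuotientGroup.mk s) = Quot.mk _ (a, s) := rfl

theorem torusOrbitMap_injective (hg : ∀ n : ℤ, g ^ n = 1 ↔ (f : ℤ) ∣ n) (a : G) :
    Function.Injective (torusOrbitMap (c := c) hg a) := by
  intro x y
  induction x using QuotientGroup.induction_on with | H s => ?_
  induction y using QuotientGroup.induction_on with | H t => ?_
  intro h
  obtain ⟨n, hn⟩ := MappingTorus.mk_eq_mk_iff.mp h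
  obtain ⟨h1, h2⟩ := Prod.ext_iff.mp hn
  obtain ⟨k, rfl⟩ := (hg n).mp (by simpa using h1)
  refine QuotientGroup.eq.mpr ⟨k, ?_⟩
  simp only at h2
  simp only [h2, zpow_mul, zpow_natCast, mul_comm _ s, inv_mul_cancel_left]

/-- The `ℝ₊`-orbit of `[a, s]` is the range of the orbit map at `a`. -/
theorem torusAct_orbit_eq_range (hg : ∀ n : ℤ, g ^ n = 1 ↔ (f : ℤ) ∣ n) (a : G) (s : Rpos) :
    {y | ∃ t : Rpos, y = torusAct g c t (Quot.mk _ (a, s))} =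
      Set.range (torusOrbitMap (c := c) hg a) := by
  ext y
  constructor
  · rintro ⟨t, rfl⟩
    exact ⟨QuotientGroup.mk (t * s), rfl⟩
  · rintro ⟨x, rfl⟩
    induction x using QuotientGroup.induction_on with | H t => ?_
    refine ⟨t * s⁻¹, ?_⟩
    change _ = Quot.mk _ (a, t * s⁻¹ * s)
    rw [inv_mul_cancel_right, torusOrbitMap_mk]

/-- The preimage in `G × ℝ₊` of the image of a set under the orbit map at `a` is a finite union
of slices over the points `gⁱ * a`, `i < f`. -/
theorem preimage_torusOrbitMap_image (hf : 0 < f) (hg : ∀ n : ℤ, g ^ n = 1 ↔ (f : ℤ) ∣ n) (a : G)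
    (D : Set (Rpos ⧸ Subgroup.zpowers (c ^ f))) :
    (Quot.mk _ : G × Rpos → MappingTorus g c) ⁻¹' (torusOrbitMap hg a '' D) =
      ⋃ i : Fin f, {g ^ (i : ℕ) * a} ×ˢ
        ((fun t : Rpos => (QuotientGroup.mk ((c ^ (i : ℕ))⁻¹ * t) :
          Rpos ⧸ Subgroup.zpowers (c ^ f))) ⁻¹' D) := by
  ext ⟨b, t⟩
  simp only [Set.mem_preimage, Set.mem_iUnion, Set.mem_prod, Set.mem_singleton_iff]
  constructor
  · rintro ⟨x, hx, h⟩
    induction x using QuotientGroup.induction_on with | H s => ?_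
    obtain ⟨n, hn⟩ := MappingTorus.mk_eq_mk_iff.mp h
    obtain ⟨rfl, rfl⟩ := Prod.ext_iff.mp hn
    have hf' : (0 : ℤ) < f := by exact_mod_cast hf
    obtain ⟨i, hi⟩ := Int.eq_ofNat_of_zero_le (Int.emod_nonneg n hf'.ne')
    have hlt : i < f := by exact_mod_cast hi ▸ Int.emod_lt_of_pos n hf'
    have hn' : n = i + f * (n / f) := by rw [← hi, Int.emod_add_mul_ediv]
    refine ⟨⟨i, hlt⟩, ?_, ?_⟩
    · rw [hn', zpow_add, (hg _).mpr (dvd_mul_right _ _), mul_one, zpow_natCast]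
    · convert hx using 1
      refine (QuotientGroup.eq.mpr (Subgroup.mem_zpowers_iff.mpr ⟨n / f, ?_⟩)).symm
      have hc : c ^ n = c ^ i * (c ^ f) ^ (n / f) := by
        conv_lhs => rw [hn', zpow_add, zpow_natCast, zpow_mul, zpow_natCast]
      change _ = s⁻¹ * ((c ^ i)⁻¹ * (c ^ n * s))
      rw [hc, mul_assoc, inv_mul_cancel_left, mul_comm _ s, inv_mul_cancel_left]
  · rintro ⟨i, rfl, h⟩
    refine ⟨_, h, ?_⟩
    rw [torusOrbitMap_mk, MappingTorus.mk_eq_mk_iff]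
    exact ⟨i, by simp⟩

variable [TopologicalSpace G]

theorem torusOrbitMap_continuous (hg : ∀ n : ℤ, g ^ n = 1 ↔ (f : ℤ) ∣ n) (a : G) :
    Continuous (torusOrbitMap (c := c) hg a) :=
  Continuous.quotient_lift (continuous_quot_mk.comp (by fun_prop)) _

theorem torusOrbitMap_isClosedEmbedding [T1Space G] (hf : 0 < f)
    (hg : ∀ n : ℤ, g ^ n = 1 ↔ (f : ℤ) ∣ n) (a : G) :
    Topology.IsClosedEmbedding (torusOrbitMap (c := c) hg a) := by
  refine .of_continuous_injective_isClosedMap (torusOrbitMap_continuous hg a)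
    (torusOrbitMap_injective hg a) fun D hD => ?_
  rw [← isQuotientMap_quot_mk.isClosed_preimage, preimage_torusOrbitMap_image hf hg]
  exact isClosed_iUnion_of_finite fun i => isClosed_singleton.prod <|
    hD.preimage (QuotientGroup.continuous_mk.comp
      ((continuous_const.mul continuous_subtype_val).subtype_mk _))

end MappingTorus

/-- A natural number coprime to `p` whose `q`-adic norm dominates that of `n` for all primes
`q ≠ p` divides `n`. -/
theorem dvd_of_padicInt_norm_le {p : Nat.Primes} {m n : ℕ} (hpm : ¬ (p : ℕ) ∣ m)
    (h : ∀ q : Nat.Primes, q ≠ p → ‖(n : ℤ_[(q : ℕ)])‖ ≤ ‖(m : ℤ_[(q : ℕ)])‖) : m ∣ n := by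
  rw [Nat.dvd_iff_prime_pow_dvd_dvd]
  intro q k hq hk
  rcases k.eq_zero_or_pos with rfl | hk0
  · simp
  obtain ⟨q, rfl⟩ : ∃ r : Nat.Primes, (r : ℕ) = q := ⟨⟨q, hq⟩, rfl⟩
  have hqp : q ≠ p := by
    rintro rfl
    exact hpm ((dvd_pow_self _ hk0.ne').trans hk)
  have key (l : ℕ) : (q : ℕ) ^ k ∣ l ↔ ‖(l : ℤ_[(q : ℕ)])‖ ≤ ((q : ℕ) : ℝ) ^ (-k : ℤ) := by
    have := PadicInt.norm_int_le_pow_iff_dvd (p := q) (k := l) (n := k)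
    rw [← Int.natCast_dvd_natCast]
    push_cast at this ⊢
    exact this.symm
  exact (key n).mpr ((h q hqp).trans ((key m).mp hk))

theorem norm_sub_one_le_of_mem_Ntor {p : Nat.Primes} {f : ℕ} {x : PUnits p} (hx : x ∈ Ntor p f)
    (q : {q : Nat.Primes // q ≠ p}) :
    ‖((x q : ℤ_[((q : Nat.Primes) : ℕ)]) - 1)‖ ≤
      ‖((p : ℕ) : ℤ_[((q : Nat.Primes) : ℕ)]) ^ f - 1‖ := by
  have hcl : IsClosed {x : PUnits p | ‖((x q : ℤ_[((q : Nat.Primes) : ℕ)]) - 1)‖ ≤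
      ‖((p : ℕ) : ℤ_[((q : Nat.Primes) : ℕ)]) ^ f - 1‖} :=
    isClosed_le (((Units.continuous_val.comp (continuous_apply q)).sub continuous_const).norm)
      continuous_const
  refine hcl.closure_subset_iff.mpr ?_ hx
  rintro _ ⟨k, rfl⟩
  set v : ℤ_[((q : Nat.Primes) : ℕ)]ˣ := uP p q ^ f with hv
  have hval : (v : ℤ_[((q : Nat.Primes) : ℕ)]) = ((p : ℕ) : ℤ_[((q : Nat.Primes) : ℕ)]) ^ f := by
    simp [hv, uP]
  have hnat (n : ℕ) : ‖((v ^ n : ℤ_[((q : Nat.Primes) : ℕ)]ˣ) : ℤ_[((q : Nat.Primes) : ℕ)]) - 1‖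
      ≤ ‖(v : ℤ_[((q : Nat.Primes) : ℕ)]) - 1‖ := by
    obtain ⟨w, hw⟩ := sub_one_dvd_pow_sub_one (v : ℤ_[((q : Nat.Primes) : ℕ)]) n
    rw [Units.val_pow_eq_pow_val, hw, norm_mul]
    exact mul_le_of_le_one_right (norm_nonneg _) (PadicInt.norm_le_one _)
  change ‖((v ^ k : ℤ_[((q : Nat.Primes) : ℕ)]ˣ) : ℤ_[((q : Nat.Primes) : ℕ)]) - 1‖ ≤ _
  rw [← hval]
  obtain ⟨n, rfl | rfl⟩ := k.eq_nat_or_neg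
  · exact_mod_cast hnat n
  · refine le_of_eq_of_le ?_ (hnat n)
    have h1 : ((v ^ (-n : ℤ) : ℤ_[((q : Nat.Primes) : ℕ)]ˣ) : ℤ_[((q : Nat.Primes) : ℕ)]) - 1 =
        ((v ^ (-n : ℤ) : ℤ_[((q : Nat.Primes) : ℕ)]ˣ) : ℤ_[((q : Nat.Primes) : ℕ)]) *
          -(((v ^ n : ℤ_[((q : Nat.Primes) : ℕ)]ˣ) : ℤ_[((q : Nat.Primes) : ℕ)]) - 1) := by
      rw [mul_neg, mul_sub, ← Units.val_mul, zpow_neg, zpow_natCast, inv_mul_cancel]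
      simp
    rw [h1, norm_mul, norm_neg, PadicInt.norm_units, one_mul]

/-- The image of `u_p` in `A` has order exactly `f`. -/
theorem gbar_zpow_eq_one_iff {p : Nat.Primes} {f : ℕ} (hf : 0 < f) (n : ℤ) :
    gbar p f ^ n = 1 ↔ (f : ℤ) ∣ n := by
  have hpow : gbar p f ^ f = 1 := by
    refine (QuotientGroup.eq_one_iff (uP p ^ f)).mpr ?_
    exact Subgroup.le_topologicalClosure _ (Subgroup.mem_zpowers _)
  have hord : orderOf (gbar p f) = f := by
    refine (orderOf_eq_iff hf).mpr ⟨hpow, fun r hr hr0 h => ?_⟩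
    have hmem : uP p ^ r ∈ Ntor p f := (QuotientGroup.eq_one_iff (uP p ^ r)).mp h
    have hp := p.2.one_lt
    have hlt : (p : ℕ) ^ r < (p : ℕ) ^ f := Nat.pow_lt_pow_right hp hr
    have hrpos : 1 < (p : ℕ) ^ r := Nat.one_lt_pow hr0.ne' hp
    have hdvd : (p : ℕ) ^ f - 1 ∣ (p : ℕ) ^ r - 1 := by
      refine dvd_of_padicInt_norm_le (p := p) (fun hd => ?_) fun q hq => ?_
      · have h1 := (Nat.dvd_sub_iff_right (by omega) (dvd_pow_self (p : ℕ) hf.ne')).mp hd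
        exact hp.ne' (Nat.dvd_one.mp h1)
      · have := norm_sub_one_le_of_mem_Ntor hmem ⟨q, hq⟩
        rw [Nat.cast_sub (by omega), Nat.cast_sub (by omega)]
        simpa [uP] using this
    exact absurd (Nat.le_of_dvd (by omega) hdvd) (by omega)
  rw [← orderOf_dvd_iff_zpow_eq_one, hord]

theorem Amod_t1Space (p : Nat.Primes) (f : ℕ) : T1Space (Amod p f) :=
  QuotientGroup.t1Space_iff.mpr (Subgroup.isClosed_topologicalClosure _)

/-- in the mapping torus of multiplication by `u_p` on `A = Ẑ_{(p)}ˣ/N`,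
`N` being the closure of the cyclic subgroup generated by `u_p^f`, the map
`ℝ₊/p^{fℤ} → T`, `class of s ↦ [aN, s]`, is well defined and a homeomorphism onto the
`ℝ₊`-orbit of `[aN, 1]`; in particular every `ℝ₊`-orbit is a closed orbit, a circle. -/
theorem statement7 (p : Nat.Primes) (f : ℕ) (hf : 0 < f) :
    (∀ a : PUnits p,
      ∃ e : (Rpos ⧸ Subgroup.zpowers (pPos p ^ f)) ≃ₜ
          {y : MappingTorus (gbar p f) (pPos p) |
            ∃ t : Rpos, y = torusAct (gbar p f) (pPos p) t
              (Quot.mk _ (QuotientGroup.mk a, 1))},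
        ∀ s : Rpos,
          (e (QuotientGroup.mk s) : MappingTorus (gbar p f) (pPos p)) =
            Quot.mk _ (QuotientGroup.mk a, s)) ∧
    ∀ x : MappingTorus (gbar p f) (pPos p),
      IsClosed {y | ∃ t : Rpos, y = torusAct (gbar p f) (pPos p) t x} := by
  have hg := gbar_zpow_eq_one_iff (p := p) hf
  have := Amod_t1Space p f
  have hemb (a : Amod p f) := torusOrbitMap_isClosedEmbedding (c := pPos p) hf hg a
  constructor
  · intro a
    exact ⟨(hemb a).isEmbedding.toHomeomorph.trans
      (Homeomorph.setCongr (torusAct_orbit_eq_range hg _ 1).symm), fun s => rfl⟩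
  · rintro ⟨a, s⟩
    rw [torusAct_orbit_eq_range hg]
    exact (hemb a).isClosed_range
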